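/- arXiv:0801.1371 — 2 statements merged into one kernel-verified Lean document; each statement's English description precedes it below -/
import Mathlib

section
/- Let X be an mm-space with total mass m = μ_X(X) > 0. Then for any κ > 0, Sep(X; κ, κ) ≤ √(2/(mκ)) · ObsL^2Var_ℝ(X) (where both sides may take the value +∞). -/
open MeasureTheory ENNReal

/-- The distance between two subsets of an (extended) metric space. -/
noncomputable def setSep {α : Type*} [PseudoEMetricSpace α] (A B : Set α) : ℝ≥0∞ :=
  ⨅ x ∈ A, EMetric.infEdist x B

/-- The separation distance `Sep(μ; κ₁, κ₂)`: the supremum of the distances `d(A,B)` over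
Borel sets `A`, `B` with `μ A ≥ κ₁` and `μ B ≥ κ₂`. -/
noncomputable def sep {α : Type*} [PseudoEMetricSpace α] [MeasurableSpace α]
    (μ : Measure α) (κ₁ κ₂ : ℝ≥0∞) : ℝ≥0∞ :=
  ⨆ (A : Set α) (B : Set α) (_ : MeasurableSet A) (_ : MeasurableSet B)
    (_ : κ₁ ≤ μ A) (_ : κ₂ ≤ μ B), setSep A B

/-- The partial diameter `diam(ν, a)`: the infimum of diameters of Borel sets of measure `≥ a`. -/
noncomputable def partialDiam {α : Type*} [PseudoEMetricSpace α] [MeasurableSpace α]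
    (ν : Measure α) (a : ℝ≥0∞) : ℝ≥0∞ :=
  ⨅ (s : Set α) (_ : MeasurableSet s) (_ : a ≤ ν s), EMetric.diam s

/-- The observable diameter `ObsDiam_Y(X; -κ)`. -/
noncomputable def obsDiam (Y : Type*) [MetricSpace Y] [MeasurableSpace Y]
    {X : Type*} [MetricSpace X] [MeasurableSpace X] (μ : Measure X) (κ : ℝ≥0∞) : ℝ≥0∞ :=
  ⨆ (f : X → Y) (_ : LipschitzWith 1 f), partialDiam (Measure.map f μ) (μ Set.univ - κ)

/-- `V_p(ν) = (∬ d(x,y)^p dν dν)^{1/p}`. -/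
noncomputable def varP {α : Type*} [PseudoEMetricSpace α] [MeasurableSpace α]
    (ν : Measure α) (p : ℝ) : ℝ≥0∞ :=
  (∫⁻ x, ∫⁻ y, edist x y ^ p ∂ν ∂ν) ^ (1 / p)

/-- The observable `L^p`-variation `ObsL^pVar_Y(X)`. -/
noncomputable def obsVar (Y : Type*) [MetricSpace Y] [MeasurableSpace Y]
    {X : Type*} [MetricSpace X] [MeasurableSpace X] (μ : Measure X) (p : ℝ) : ℝ≥0∞ :=
  ⨆ (f : X → Y) (_ : LipschitzWith 1 f), varP (Measure.map f μ) p

/-- The central radius: the infimum of `ρ > 0` such that the closed ball of radius `ρ`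
around `c` has measure at least `a`. -/
noncomputable def cRad {α : Type*} [PseudoEMetricSpace α] [MeasurableSpace α]
    (ν : Measure α) (c : α) (a : ℝ≥0∞) : ℝ≥0∞ :=
  sInf {ρ : ℝ≥0∞ | 0 < ρ ∧ a ≤ ν (EMetric.closedBall c ρ)}

/-- `z₀` is the center of mass of `ν`: for every `z`, `z₀` is the unique minimizer of
`x ↦ ∫ (d(x,y)² - d(z,y)²) dν(y)`. -/
def IsCenterOfMass {α : Type*} [MetricSpace α] [MeasurableSpace α]
    (ν : Measure α) (z₀ : α) : Prop :=
  ∀ z x : α, x ≠ z₀ →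
    (∫ y, (dist z₀ y ^ 2 - dist z y ^ 2) ∂ν) < ∫ y, (dist x y ^ 2 - dist z y ^ 2) ∂ν

/-- `ν` has a finite first moment: `∫ d(x,y) dν(y) < ∞` for some `x`. -/
def FiniteFirstMoment {α : Type*} [MetricSpace α] [MeasurableSpace α] (ν : Measure α) : Prop :=
  ∃ x : α, (∫⁻ y, edist x y ∂ν) < ⊤

/-- `ν` has separable support. -/
def HasSeparableSupport {α : Type*} [MetricSpace α] [MeasurableSpace α] (ν : Measure α) : Prop :=
  ∃ s : Set α, TopologicalSpace.IsSeparable s ∧ ν sᶜ = 0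

/-- `γ` (restricted to `[0, d(z,w)]`) is a geodesic from `z` to `w`, i.e. an isometric
embedding of the interval `[0, d(z,w)]` sending the endpoints to `z` and `w`. -/
def IsGeodesic {T : Type*} [MetricSpace T] (z w : T) (γ : ℝ → T) : Prop :=
  γ 0 = z ∧ γ (dist z w) = w ∧
    ∀ s ∈ Set.Icc (0 : ℝ) (dist z w), ∀ t ∈ Set.Icc (0 : ℝ) (dist z w),
      dist (γ s) (γ t) = |s - t|

/-- An `ℝ`-tree: a complete geodesic metric space which is `0`-hyperbolic. -/
def IsRTree (T : Type*) [MetricSpace T] : Prop :=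
  CompleteSpace T ∧ (∀ z w : T, ∃ γ : ℝ → T, IsGeodesic z w γ) ∧
    ∀ x y z w : T, dist x y + dist z w ≤ max (dist x z + dist y w) (dist x w + dist y z)

/-- A set is (geodesically) convex if every geodesic joining two of its points stays in it. -/
def GeodConvex {T : Type*} [MetricSpace T] (s : Set T) : Prop :=
  ∀ z ∈ s, ∀ w ∈ s, ∀ γ : ℝ → T, IsGeodesic z w γ →
    γ '' Set.Icc (0 : ℝ) (dist z w) ⊆ s

/-- `z` is a median of `ν`: there are closed convex `T'`, `T''` covering the space with
`T' ∩ T'' = {z}` and both of measure at least `ν(univ)/3`. -/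
def IsMedian {T : Type*} [MetricSpace T] [MeasurableSpace T] (ν : Measure T) (z : T) : Prop :=
  ∃ T' T'' : Set T, IsClosed T' ∧ IsClosed T'' ∧ GeodConvex T' ∧ GeodConvex T'' ∧
    T' ∪ T'' = Set.univ ∧ T' ∩ T'' = {z} ∧
    ν Set.univ / 3 ≤ ν T' ∧ ν Set.univ / 3 ≤ ν T''

/-- The observable central radius `ObsCRad_Y(X; -κ)`, the supremum of the central radii of
push-forwards under `1`-Lipschitz maps (taken at their centers of mass). -/
noncomputable def obsCRad (Y : Type*) [MetricSpace Y] [MeasurableSpace Y]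
    {X : Type*} [MetricSpace X] [MeasurableSpace X] (μ : Measure X) (κ : ℝ≥0∞) : ℝ≥0∞ :=
  ⨆ (f : X → Y) (_ : LipschitzWith 1 f) (c : Y) (_ : IsCenterOfMass (Measure.map f μ) c),
    cRad (Measure.map f μ) c (μ Set.univ - κ)

theorem setSep_le_edist {α : Type*} [PseudoEMetricSpace α] {A B : Set α} {x y : α}
    (hx : x ∈ A) (hy : y ∈ B) : setSep A B ≤ edist x y :=
  (iInf₂_le x hx).trans (Metric.infEDist_le_edist_of_mem hy)

/-- If `S` and `T` are disjoint sets of measure at least `κ` at distance at least `D`, then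
every point has second moment at least `κ D² / 2`. -/
theorem mul_rpow_two_le_two_mul_lintegral_edist {α : Type*} [PseudoEMetricSpace α]
    [MeasurableSpace α] (ν : Measure α) {S T : Set α} {κ D : ℝ≥0∞}
    (hS : MeasurableSet S) (hT : MeasurableSet T) (hST : Disjoint S T)
    (hκS : κ ≤ ν S) (hκT : κ ≤ ν T) (hD : ∀ s ∈ S, ∀ t ∈ T, D ≤ edist s t) (x : α) :
    κ * D ^ (2 : ℝ) ≤ 2 * ∫⁻ y, edist x y ^ (2 : ℝ) ∂ν := by
  have hsum : D ≤ Metric.infEDist x S + Metric.infEDist x T := by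
    simp only [Metric.infEDist, ENNReal.iInf_add, ENNReal.add_iInf]
    refine le_iInf₂ fun t ht => le_iInf₂ fun s hs => (hD s hs t ht).trans ?_
    exact edist_triangle_left s t x
  have hsq : D ^ (2 : ℝ) ≤
      2 * (Metric.infEDist x S ^ (2 : ℝ) + Metric.infEDist x T ^ (2 : ℝ)) := by
    refine (ENNReal.rpow_le_rpow hsum zero_le_two).trans ?_
    refine (ENNReal.rpow_add_le_mul_rpow_add_rpow _ _ one_le_two).trans_eq ?_
    norm_num
  have hset : ∀ U : Set α, MeasurableSet U → κ ≤ ν U →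
      κ * Metric.infEDist x U ^ (2 : ℝ) ≤ ∫⁻ y in U, edist x y ^ (2 : ℝ) ∂ν := by
    intro U hU hκU
    calc κ * Metric.infEDist x U ^ (2 : ℝ)
        ≤ Metric.infEDist x U ^ (2 : ℝ) * ν U := by rw [mul_comm]; gcongr
      _ = ∫⁻ _ in U, Metric.infEDist x U ^ (2 : ℝ) ∂ν := (setLIntegral_const _ _).symm
      _ ≤ ∫⁻ y in U, edist x y ^ (2 : ℝ) ∂ν :=
        setLIntegral_mono' hU fun y hy =>
          ENNReal.rpow_le_rpow (Metric.infEDist_le_edist_of_mem hy) zero_le_two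
  calc κ * D ^ (2 : ℝ)
      ≤ κ * (2 * (Metric.infEDist x S ^ (2 : ℝ) + Metric.infEDist x T ^ (2 : ℝ))) := by gcongr
    _ = 2 * (κ * Metric.infEDist x S ^ (2 : ℝ) + κ * Metric.infEDist x T ^ (2 : ℝ)) := by ring
    _ ≤ 2 * (∫⁻ y in S, edist x y ^ (2 : ℝ) ∂ν + ∫⁻ y in T, edist x y ^ (2 : ℝ) ∂ν) := by
      gcongr
      exacts [hset S hS hκS, hset T hT hκT]
    _ = 2 * ∫⁻ y in S ∪ T, edist x y ^ (2 : ℝ) ∂ν := by rw [lintegral_union hT hST]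
    _ ≤ 2 * ∫⁻ y, edist x y ^ (2 : ℝ) ∂ν := by
      gcongr
      exact Measure.restrict_le_self

/-- Two disjoint sets of measure at least `κ` at distance at least `D` bound `V_2` from below. -/
theorem le_sqrt_mul_varP_two {α : Type*} [PseudoEMetricSpace α]
    [MeasurableSpace α] (ν : Measure α) [IsFiniteMeasure ν] (hν : 0 < ν Set.univ)
    {S T : Set α} {κ D : ℝ≥0∞} (hκ0 : 0 < κ) (hκ : κ ≠ ⊤)
    (hS : MeasurableSet S) (hT : MeasurableSet T) (hST : Disjoint S T)
    (hκS : κ ≤ ν S) (hκT : κ ≤ ν T) (hD : ∀ s ∈ S, ∀ t ∈ T, D ≤ edist s t) :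
    D ≤ (2 / (ν Set.univ * κ)) ^ ((1 : ℝ) / 2) * varP ν 2 := by
  have hint : κ * D ^ (2 : ℝ) * ν Set.univ ≤
      2 * ∫⁻ x, ∫⁻ y, edist x y ^ (2 : ℝ) ∂ν ∂ν := by
    rw [← lintegral_const, ← lintegral_const_mul' _ _ ENNReal.ofNat_ne_top]
    exact lintegral_mono fun x =>
      mul_rpow_two_le_two_mul_lintegral_edist ν hS hT hST hκS hκT hD x
  have hsq : D ^ (2 : ℝ) ≤
      2 / (ν Set.univ * κ) * ∫⁻ x, ∫⁻ y, edist x y ^ (2 : ℝ) ∂ν ∂ν := by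
    rw [← ENNReal.mul_div_right_comm, ENNReal.le_div_iff_mul_le
      (Or.inl (mul_pos hν.ne' hκ0.ne').ne')
      (Or.inl (ENNReal.mul_ne_top (measure_ne_top ν _) hκ))]
    exact le_of_eq_of_le (by ring) hint
  calc D = (D ^ (2 : ℝ)) ^ ((1 : ℝ) / 2) := by
        rw [← ENNReal.rpow_mul]; norm_num
    _ ≤ _ := ENNReal.rpow_le_rpow hsq (by norm_num)
    _ = _ := by rw [ENNReal.mul_rpow_of_nonneg _ _ (by norm_num), varP]

/-- For an mm-space `X` with `m = μ_X(X) > 0` and any `κ > 0`,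
`Sep(X; κ, κ) ≤ √(2/(mκ)) · ObsL²Var_ℝ(X)` (in `ℝ≥0∞`). -/
theorem sep_le_sqrt_obsVarTwo {X : Type*} [MetricSpace X] [CompleteSpace X]
    [TopologicalSpace.SeparableSpace X] [MeasurableSpace X] [BorelSpace X]
    (μ : Measure X) [IsFiniteMeasure μ] (hm : 0 < μ Set.univ)
    (κ : ℝ≥0∞) (hκ0 : 0 < κ) (hκ : κ ≠ ⊤) :
    sep μ κ κ ≤ (2 / (μ Set.univ * κ)) ^ ((1 : ℝ) / 2) * obsVar ℝ μ 2 := by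
  refine iSup_le fun A => iSup_le fun B => iSup_le fun _ => iSup_le fun _ => iSup_le fun hA =>
    iSup_le fun hB => ?_
  rcases eq_zero_or_pos (setSep A B) with h0 | hpos
  · simp [h0]
  have hAne : A.Nonempty := nonempty_of_measure_ne_zero (hκ0.trans_le hA).ne'
  have hf : LipschitzWith 1 fun x => Metric.infDist x A := Metric.lipschitz_infDist_pt A
  have hfm : Measurable fun x => Metric.infDist x A := hf.continuous.measurable
  set ν := Measure.map (fun x => Metric.infDist x A) μ with hνdef
  have hνuniv : ν Set.univ = μ Set.univ := by
    rw [hνdef, Measure.map_apply hfm MeasurableSet.univ, Set.preimage_univ]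
  have hTm : MeasurableSet {t : ℝ | setSep A B ≤ edist 0 t} :=
    measurableSet_le measurable_const (by fun_prop)
  have hmass : ∀ (U : Set X) (V : Set ℝ), MeasurableSet V → κ ≤ μ U →
      (∀ x ∈ U, Metric.infDist x A ∈ V) → κ ≤ ν V := by
    intro U V hV hU hUV
    rw [hνdef, Measure.map_apply hfm hV]
    exact hU.trans (measure_mono hUV)
  have hle := le_sqrt_mul_varP_two ν (S := {0}) (T := {t : ℝ | setSep A B ≤ edist 0 t})
    (D := setSep A B) (hνuniv ▸ hm) hκ0 hκ (measurableSet_singleton 0) hTm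
    (Set.disjoint_singleton_left.2 (by simpa using hpos.ne'))
    (hmass A _ (measurableSet_singleton 0) hA fun x hx => Metric.infDist_zero_of_mem hx)
    (hmass B _ hTm hB fun y hy => by
      rw [Set.mem_ofPred_eq, edist_comm, edist_dist, Real.dist_0_eq_abs,
        abs_of_nonneg Metric.infDist_nonneg, Metric.infDist,
        ENNReal.ofReal_toReal (Metric.infEDist_ne_top hAne)]
      refine Metric.le_infEDist.2 fun x hx => ?_
      rw [edist_comm]
      exact setSep_le_edist hx hy)
    (by rintro s rfl t ht; exact ht)
  rw [hνuniv] at hle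
  refine hle.trans ?_
  gcongr
  exact le_iSup₂_of_le _ hf le_rfl
end

section
/- Let {X_n} be a sequence of mm-spaces whose measures have finite first moment (so that all centers of mass below exist, ℝ-trees being CAT(0)). Then ObsCRad_ℝ(X_n; −κ) → 0 as n → ∞ for every κ > 0 if and only if sup{ ObsCRad_T(X_n; −κ) : T is an ℝ-tree } → 0 as n → ∞ for every κ > 0. -/
open MeasureTheory ENNReal

universe u v

/-- The integral in the definition of the center of mass, for a push-forward. -/
theorem integral_sq_dist_sub_map {X T : Type*} [MeasurableSpace X] (μ : Measure X)
    [MetricSpace T] [MeasurableSpace T] [BorelSpace T] {f : X → T} (hf : Measurable f) (a z : T) :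
    ∫ y, (dist a y ^ 2 - dist z y ^ 2) ∂(Measure.map f μ)
      = ∫ x, (dist a (f x) ^ 2 - dist z (f x) ^ 2) ∂μ := by
  refine integral_map hf.aemeasurable (Measurable.aestronglyMeasurable ?_)
  exact Continuous.measurable (by fun_prop)

/-- The central radius of a push-forward. -/
theorem cRad_map {X T : Type*} [MeasurableSpace X] (μ : Measure X)
    [MetricSpace T] [MeasurableSpace T] [BorelSpace T] {f : X → T} (hf : Measurable f) (c : T)
    (a : ℝ≥0∞) :
    cRad (Measure.map f μ) c a = sInf {ρ | 0 < ρ ∧ a ≤ μ {x | edist (f x) c ≤ ρ}} := by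
  have h : ∀ ρ, Measure.map f μ (Metric.closedEBall c ρ) = μ {x | edist (f x) c ≤ ρ} :=
    fun ρ => Measure.map_apply hf Metric.isClosed_closedEBall.measurableSet
  simp_rw [← h]
  rfl

/-- The mean of an integrable function is the center of mass of its distribution. -/
theorem isCenterOfMass_map_mean {X : Type*} [MeasurableSpace X] (μ : Measure X)
    [IsFiniteMeasure μ] (hμ : μ ≠ 0) {h : X → ℝ} (hm : Measurable h) (hi : Integrable h μ) :
    IsCenterOfMass (Measure.map h μ) ((∫ x, h x ∂μ) / μ.real Set.univ) := by
  have hpos : 0 < μ.real Set.univ := by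
    have : NeZero μ := ⟨hμ⟩
    exact measureReal_univ_pos
  set b := (∫ x, h x ∂μ) / μ.real Set.univ with hb
  have hint : ∫ x, h x ∂μ = b * μ.real Set.univ := by
    rw [hb]; field_simp
  have key : ∀ a z : ℝ, ∫ x, (dist a (h x) ^ 2 - dist z (h x) ^ 2) ∂μ
      = (a ^ 2 - z ^ 2 - 2 * (a - z) * b) * μ.real Set.univ := by
    intro a z
    have : ∀ x, dist a (h x) ^ 2 - dist z (h x) ^ 2
        = (a ^ 2 - z ^ 2) - (2 * (a - z)) * h x := by
      intro x
      rw [Real.dist_eq, Real.dist_eq, sq_abs, sq_abs]; ring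
    simp_rw [this]
    rw [integral_sub (integrable_const _) (hi.const_mul _), integral_const_mul, hint,
      integral_const, smul_eq_mul]
    ring
  intro z x hx
  rw [integral_sq_dist_sub_map μ hm, integral_sq_dist_sub_map μ hm, key, key]
  refine mul_lt_mul_of_pos_right ?_ hpos
  have : 0 < (x - b) ^ 2 := by
    have := sub_ne_zero.2 hx
    positivity
  nlinarith

/-- A bound on the observable central radius gives concentration around the mean. -/
theorem measure_lt_abs_sub_mean_le {X : Type*} [MetricSpace X] [MeasurableSpace X] [BorelSpace X]
    (μ : Measure X) [IsFiniteMeasure μ] {κ : ℝ≥0∞} {δ : ℝ}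
    (hδ : obsCRad ℝ μ κ < ENNReal.ofReal δ) {h : X → ℝ} (hL : LipschitzWith 1 h)
    (hi : Integrable h μ) :
    μ {x | δ < |h x - (∫ x, h x ∂μ) / μ.real Set.univ|} ≤ κ := by
  rcases eq_or_ne μ 0 with rfl | hμ
  · simp
  have hm : Measurable h := hL.continuous.measurable
  set b := (∫ x, h x ∂μ) / μ.real Set.univ with hb
  have hc : IsCenterOfMass (Measure.map h μ) b := isCenterOfMass_map_mean μ hμ hm hi
  have h1 : cRad (Measure.map h μ) b (μ Set.univ - κ) ≤ obsCRad ℝ μ κ :=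
    le_iSup₂_of_le h hL (le_iSup₂_of_le b hc le_rfl)
  rw [cRad_map μ hm] at h1
  obtain ⟨ρ, ⟨-, hρ⟩, hρδ⟩ := sInf_lt_iff.1 (lt_of_le_of_lt h1 hδ)
  have hS : MeasurableSet {x | δ < |h x - b|} :=
    measurableSet_lt measurable_const (by fun_prop)
  have hsub : {x | edist (h x) b ≤ ρ} ⊆ {x | δ < |h x - b|}ᶜ := by
    intro x hx
    simp only [Set.mem_compl_iff, Set.mem_ofPred_eq, not_lt]
    have h2 : edist (h x) b < ENNReal.ofReal δ := lt_of_le_of_lt hx hρδ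
    rw [edist_dist, ENNReal.ofReal_lt_ofReal_iff_of_nonneg dist_nonneg, Real.dist_eq] at h2
    exact h2.le
  have h3 := hρ.trans (measure_mono hsub)
  have h4 : μ Set.univ ≤ κ + μ {x | δ < |h x - b|}ᶜ := tsub_le_iff_left.1 h3
  rw [← measure_add_measure_compl hS] at h4
  exact (ENNReal.add_le_add_iff_right (measure_ne_top _ _)).1 h4

/-- Two points lie in the same direction from `c` if their Gromov product at `c` is positive. -/
def SameDirection {T : Type*} [MetricSpace T] (c y z : T) : Prop :=
  dist y z < dist c y + dist c z

section SameDirection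

variable {T : Type*} [MetricSpace T] {c : T}

theorem sameDirection_self {y : T} (hy : y ≠ c) : SameDirection c y y := by
  have := dist_pos.2 hy.symm
  simp only [SameDirection, dist_self]
  linarith

theorem not_sameDirection_left (y : T) : ¬ SameDirection c c y := by
  simp [SameDirection]

theorem SameDirection.trans (hT : IsRTree T) {x y z : T} (hxy : SameDirection c x y)
    (hyz : SameDirection c y z) : SameDirection c x z := by
  have h := hT.2.2 x z y c
  simp only [SameDirection] at *
  rw [dist_comm x c, dist_comm y c, dist_comm z c, dist_comm z y] at h
  rcases le_max_iff.1 h with h | h <;> linarith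

theorem isOpen_setOf_sameDirection_left (c p : T) : IsOpen {y | SameDirection c y p} :=
  isOpen_lt (by fun_prop) (by fun_prop)

open Classical in
/-- The distance to `c`, with positive sign on `A` and negative sign off `A`. -/
noncomputable def branchDist (c : T) (A : Set T) (y : T) : ℝ :=
  if y ∈ A then dist c y else - dist c y

theorem abs_branchDist (A : Set T) (y : T) : |branchDist c A y| = dist c y := by
  unfold branchDist
  split_ifs <;> simp

/-- The signed distance is `1`-Lipschitz when no direction meets both `A` and its complement. -/
theorem lipschitzWith_branchDist {A : Set T}
    (hA : ∀ y ∈ A, ∀ z ∉ A, ¬ SameDirection c y z) : LipschitzWith 1 (branchDist c A) := by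
  refine LipschitzWith.of_dist_le_mul fun y z => ?_
  simp only [NNReal.coe_one, one_mul, Real.dist_eq, branchDist]
  have h1 := dist_triangle c y z
  have h2 := dist_triangle c z y
  have h3 := dist_comm y z
  have h4 := dist_nonneg (x := c) (y := y)
  have h5 := dist_nonneg (x := c) (y := z)
  rw [abs_le]
  split_ifs with hy hz hz
  · constructor <;> linarith
  · have := not_lt.1 (hA y hy z hz)
    constructor <;> linarith
  · have := not_lt.1 (hA z hz y hy)
    constructor <;> linarith
  · constructor <;> linarith

/-- A point on a geodesic issuing from `c` towards `p`, seen from a point `y`. -/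
theorem dist_geodesic_le (hT : IsRTree T) {p q : T} {t : ℝ} (hcq : dist c q = t)
    (hqp : dist q p = dist c p - t) (y : T) :
    dist q y ≤ dist c y + t - min (dist c p + dist c y - dist p y) (2 * t) := by
  have h := hT.2.2 q y c p
  rw [dist_comm q c, dist_comm y p, dist_comm y c, hcq, hqp] at h
  rcases le_max_iff.1 h with h | h
  · have := min_le_left (dist c p + dist c y - dist p y) (2 * t)
    linarith
  · have := min_le_right (dist c p + dist c y - dist p y) (2 * t)
    linarith

/-- No direction carries more than half of the first moment about the center of mass. -/
theorem integral_branchDist_nonpos {X : Type*} [MeasurableSpace X] {μ : Measure X}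
    [IsFiniteMeasure μ] [MeasurableSpace T] [BorelSpace T] (hT : IsRTree T) {f : X → T}
    (hf : Measurable f) (hi : Integrable (fun x => dist c (f x)) μ)
    (hc : IsCenterOfMass (Measure.map f μ) c) {p : T} (hp : p ≠ c) :
    ∫ x, branchDist c {y | SameDirection c p y} (f x) ∂μ ≤ 0 := by
  have hD : 0 < dist c p := dist_pos.2 hp.symm
  obtain ⟨γ, hγ0, hγ1, hγ⟩ := hT.2.1 c p
  set s : X → ℝ := fun x => dist c p + dist c (f x) - dist p (f x) with hs
  have hs0 : ∀ x, 0 ≤ s x := fun x => by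
    have := dist_triangle_left p (f x) c
    simp only [hs]; linarith
  have hsm : Measurable s :=
    (Continuous.measurable (f := fun y => dist c p + dist c y - dist p y) (by fun_prop)).comp hf
  have hdm : Measurable fun x => dist c (f x) :=
    (Continuous.measurable (f := fun y => dist c y) (by fun_prop)).comp hf
  set t : ℕ → ℝ := fun n => dist c p / (n + 1) with ht
  have ht0 : ∀ n, 0 < t n := fun n => by positivity
  have htD : ∀ n, t n ≤ dist c p := fun n => div_le_self hD.le (by
    have : (0 : ℝ) ≤ n := n.cast_nonneg
    linarith)
  have htlim : Filter.Tendsto t Filter.atTop (nhds 0) :=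
    tendsto_const_div_atTop_nhds_zero_nat (dist c p) |>.comp (Filter.tendsto_add_atTop_nat 1)
      |>.congr fun n => by simp [ht]
  set a : ℕ → X → ℝ := fun n x => 1 - min (s x) (2 * t n) / t n with ha
  have ha1 : ∀ n x, |a n x| ≤ 1 := fun n x => by
    have h0 : 0 ≤ min (s x) (2 * t n) / t n :=
      div_nonneg (le_min (hs0 x) (by linarith [ht0 n])) (ht0 n).le
    have h2 : min (s x) (2 * t n) / t n ≤ 2 :=
      (div_le_iff₀ (ht0 n)).2 (min_le_right _ _)
    rw [abs_le]
    simp only [ha]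
    constructor <;> linarith
  set F : ℕ → X → ℝ := fun n x => a n x * (2 * dist c (f x) + t n * a n x) with hF
  have hbound : ∀ n x, ‖F n x‖ ≤ 2 * dist c (f x) + dist c p := fun n x => by
    have h1 := ha1 n x
    have h3 : |t n * a n x| ≤ dist c p := by
      rw [abs_mul, abs_of_pos (ht0 n)]
      calc t n * |a n x| ≤ t n * 1 := mul_le_mul_of_nonneg_left h1 (ht0 n).le
        _ ≤ dist c p := by linarith [htD n]
    have h4 : |2 * dist c (f x) + t n * a n x| ≤ 2 * dist c (f x) + dist c p := by
      refine (abs_add_le _ _).trans (add_le_add (le_of_eq (abs_of_nonneg (by positivity))) h3)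
    rw [hF, Real.norm_eq_abs, abs_mul]
    calc |a n x| * |2 * dist c (f x) + t n * a n x| ≤ 1 * |2 * dist c (f x) + t n * a n x| :=
          mul_le_mul_of_nonneg_right h1 (abs_nonneg _)
      _ ≤ _ := by rw [one_mul]; exact h4
  have hFm : ∀ n, AEStronglyMeasurable (F n) μ := fun n =>
    Measurable.aestronglyMeasurable (by fun_prop)
  have hbi : Integrable (fun x => 2 * dist c (f x) + dist c p) μ :=
    (hi.const_mul 2).add (integrable_const _)
  have hFi : ∀ n, Integrable (F n) μ := fun n =>
    hbi.mono' (hFm n) (Filter.Eventually.of_forall (hbound n))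
  have hpos : ∀ n, 0 ≤ ∫ x, F n x ∂μ := by
    intro n
    have hmem : t n ∈ Set.Icc 0 (dist c p) := ⟨(ht0 n).le, htD n⟩
    have hcq : dist c (γ (t n)) = t n := by
      have := hγ 0 ⟨le_rfl, hD.le⟩ (t n) hmem
      rwa [hγ0, zero_sub, abs_neg, abs_of_pos (ht0 n)] at this
    have hqp : dist (γ (t n)) p = dist c p - t n := by
      have := hγ (t n) hmem (dist c p) ⟨hD.le, le_rfl⟩
      rwa [hγ1, abs_sub_comm, abs_of_nonneg (by linarith [htD n])] at this
    have hne : γ (t n) ≠ c := by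
      intro h
      rw [h, dist_self] at hcq
      exact (ht0 n).ne hcq
    have h1 := hc c (γ (t n)) hne
    rw [integral_sq_dist_sub_map μ hf, integral_sq_dist_sub_map μ hf] at h1
    simp only [sub_self, integral_zero] at h1
    have hle : ∀ x, dist (γ (t n)) (f x) ^ 2 - dist c (f x) ^ 2 ≤ t n * F n x := by
      intro x
      have h2 := dist_geodesic_le hT hcq hqp (f x)
      have h3 : dist c (f x) + t n - min (s x) (2 * t n) = dist c (f x) + t n * a n x := by
        have := (ht0 n).ne'
        simp only [ha]
        field_simp
        ring
      have h4 : dist (γ (t n)) (f x) ≤ dist c (f x) + t n * a n x := h2.trans h3.le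
      have h5 := pow_le_pow_left₀ dist_nonneg h4 2
      simp only [hF]
      nlinarith
    have hint : Integrable (fun x => dist (γ (t n)) (f x) ^ 2 - dist c (f x) ^ 2) μ := by
      by_contra hcon
      rw [integral_undef hcon] at h1
      exact lt_irrefl _ h1
    have h6 := integral_mono hint ((hFi n).const_mul (t n)) hle
    rw [integral_const_mul] at h6
    by_contra hcon
    nlinarith [ht0 n]
  have hlim : Filter.Tendsto (fun n => ∫ x, F n x ∂μ) Filter.atTop
      (nhds (∫ x, -2 * branchDist c {y | SameDirection c p y} (f x) ∂μ)) := by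
    refine tendsto_integral_of_dominated_convergence _ hFm hbi
      (fun n => Filter.Eventually.of_forall (hbound n)) (Filter.Eventually.of_forall fun x => ?_)
    by_cases hx : SameDirection c p (f x)
    · have hsx : 0 < s x := by
        simp only [SameDirection] at hx
        simp only [hs]; linarith
      have hev : ∀ᶠ n in Filter.atTop, t n < s x / 2 :=
        htlim.eventually (gt_mem_nhds (by linarith))
      have hl : Filter.Tendsto (fun n => -1 * (2 * dist c (f x) + t n * -1)) Filter.atTop
          (nhds (-1 * (2 * dist c (f x) + 0 * -1))) :=
        ((htlim.mul_const _).const_add _).const_mul _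
      have hval : -2 * branchDist c {y | SameDirection c p y} (f x)
          = -1 * (2 * dist c (f x) + 0 * -1) := by
        rw [branchDist, if_pos (show f x ∈ {y | SameDirection c p y} from hx)]; ring
      rw [hval]
      refine hl.congr' (hev.mono fun n hn => ?_)
      have : a n x = -1 := by
        have := (ht0 n).ne'
        simp only [ha]
        rw [min_eq_right (by linarith)]
        field_simp
        norm_num
      simp only [hF, this]
    · have hsx : s x = 0 := by
        refine le_antisymm ?_ (hs0 x)
        simp only [SameDirection, not_lt] at hx
        simp only [hs]; linarith
      have hl : Filter.Tendsto (fun n => 1 * (2 * dist c (f x) + t n * 1)) Filter.atTop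
          (nhds (1 * (2 * dist c (f x) + 0 * 1))) :=
        ((htlim.mul_const _).const_add _).const_mul _
      have hval : -2 * branchDist c {y | SameDirection c p y} (f x)
          = 1 * (2 * dist c (f x) + 0 * 1) := by
        rw [branchDist, if_neg (show f x ∉ {y | SameDirection c p y} from hx)]; ring
      rw [hval]
      refine hl.congr fun n => ?_
      have : a n x = 1 := by
        simp only [ha, hsx]
        rw [min_eq_left (by linarith [ht0 n])]
        simp
      simp only [hF, this]
  have h7 := ge_of_tendsto' hlim hpos
  rw [integral_const_mul] at h7
  linarith

end SameDirection

/-- The distance to a point is integrable along Lipschitz images of measures with finite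
first moment. -/
theorem FiniteFirstMoment.integrable_dist_comp {X T : Type*} [MetricSpace X] [MeasurableSpace X]
    [BorelSpace X] {μ : Measure X} [IsFiniteMeasure μ] (hmom : FiniteFirstMoment μ)
    [MetricSpace T] {f : X → T} (hf : LipschitzWith 1 f) (c : T) :
    Integrable (fun x => dist c (f x)) μ := by
  obtain ⟨x₀, hx₀⟩ := hmom
  have h1 : Integrable (fun x => dist x₀ x) μ := by
    refine ⟨(Continuous.measurable (by fun_prop)).aestronglyMeasurable, ?_⟩
    refine lt_of_le_of_lt (le_of_eq (lintegral_congr fun x => ?_)) hx₀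
    rw [edist_dist, ← ofReal_norm, Real.norm_of_nonneg dist_nonneg]
  refine ((integrable_const (dist c (f x₀))).add h1).mono'
    (Continuous.measurable ?_).aestronglyMeasurable (Filter.Eventually.of_forall fun x => ?_)
  · have := hf.continuous
    fun_prop
  · rw [Real.norm_of_nonneg dist_nonneg]
    have h2 := hf.dist_le_mul x₀ x
    rw [NNReal.coe_one, one_mul] at h2
    exact (dist_triangle c (f x₀) (f x)).trans (by simpa using h2)

/-- The observable central radius with screens in a tree is controlled by the one with
screen `ℝ`. -/
theorem obsCRad_tree_le {X : Type*} [MetricSpace X] [TopologicalSpace.SeparableSpace X]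
    [MeasurableSpace X] [BorelSpace X] (μ : Measure X) [IsFiniteMeasure μ]
    (hmom : FiniteFirstMoment μ) {κ : ℝ≥0∞} {δ : ℝ} (hδ : obsCRad ℝ μ κ < ENNReal.ofReal δ)
    {T : Type*} [MetricSpace T] [MeasurableSpace T] [BorelSpace T] (hT : IsRTree T) :
    obsCRad T μ (κ + κ + κ) ≤ ENNReal.ofReal δ := by
  have hδ0 : 0 < δ := ENNReal.ofReal_pos.1 (lt_of_le_of_lt zero_le hδ)
  refine iSup₂_le fun f hf => iSup₂_le fun c hc => ?_
  have hfm : Measurable f := hf.continuous.measurable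
  have hdi : Integrable (fun x => dist c (f x)) μ := hmom.integrable_dist_comp hf c
  have : Nonempty X := ⟨hmom.choose⟩
  have hLip : ∀ A : Set T, (∀ y ∈ A, ∀ z ∉ A, ¬ SameDirection c y z) →
      LipschitzWith 1 (fun x => branchDist c A (f x)) := fun A hA => by
    simpa [Function.comp_def] using (lipschitzWith_branchDist hA).comp hf
  have hInt : ∀ A : Set T, (∀ y ∈ A, ∀ z ∉ A, ¬ SameDirection c y z) →
      Integrable (fun x => branchDist c A (f x)) μ := fun A hA =>
    hdi.mono' (hLip A hA).continuous.measurable.aestronglyMeasurable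
      (Filter.Eventually.of_forall fun x => by rw [Real.norm_eq_abs, abs_branchDist])
  set S : Set X := {x | δ < dist c (f x)} with hS
  have hpos : ∀ A : Set T, (∀ y ∈ A, ∀ z ∉ A, ¬ SameDirection c y z) →
      ∫ x, branchDist c A (f x) ∂μ ≤ 0 → μ (f ⁻¹' A ∩ S) ≤ κ := by
    intro A hA hle
    refine (measure_mono ?_).trans (measure_lt_abs_sub_mean_le μ hδ (hLip A hA) (hInt A hA))
    rintro x ⟨hxA, hxS⟩
    have h1 : branchDist c A (f x) = dist c (f x) := if_pos hxA
    have h2 : (∫ x, branchDist c A (f x) ∂μ) / μ.real Set.univ ≤ 0 :=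
      div_nonpos_of_nonpos_of_nonneg hle measureReal_nonneg
    simp only [hS, Set.mem_ofPred_eq] at hxS ⊢
    rw [h1]
    exact lt_of_lt_of_le (by linarith) (le_abs_self _)
  have hneg : ∀ A : Set T, (∀ y ∈ A, ∀ z ∉ A, ¬ SameDirection c y z) →
      0 ≤ ∫ x, branchDist c A (f x) ∂μ → μ (S \ f ⁻¹' A) ≤ κ := by
    intro A hA hle
    refine (measure_mono ?_).trans (measure_lt_abs_sub_mean_le μ hδ (hLip A hA) (hInt A hA))
    rintro x ⟨hxS, hxA⟩
    have h1 : branchDist c A (f x) = - dist c (f x) := if_neg hxA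
    have h2 : 0 ≤ (∫ x, branchDist c A (f x) ∂μ) / μ.real Set.univ :=
      div_nonneg hle measureReal_nonneg
    simp only [hS, Set.mem_ofPred_eq] at hxS ⊢
    rw [h1]
    exact lt_of_lt_of_le (by linarith) (neg_le_abs _)
  set C : ℕ → Set T := fun i =>
    {y | SameDirection c (f (TopologicalSpace.denseSeq X i)) y} with hC
  have hCsat : ∀ i, ∀ y ∈ C i, ∀ z ∉ C i, ¬ SameDirection c y z :=
    fun i y hy z hz hyz => hz (SameDirection.trans hT hy hyz)
  have hCle : ∀ i, μ (f ⁻¹' C i ∩ S) ≤ κ := by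
    intro i
    by_cases hi : f (TopologicalSpace.denseSeq X i) = c
    · have : C i = ∅ := by
        ext y
        simp [hC, hi, not_sameDirection_left]
      simp [this]
    · exact hpos _ (hCsat i) (integral_branchDist_nonpos hT hfm hdi hc hi)
  set A : ℕ → Set T := fun k => ⋃ i < k, C i with hA
  have hAsat : ∀ k, ∀ y ∈ A k, ∀ z ∉ A k, ¬ SameDirection c y z := by
    intro k y hy z hz
    simp only [hA, Set.mem_iUnion, exists_prop] at hy hz
    obtain ⟨i, hik, hyi⟩ := hy
    exact hCsat i y hyi z fun h => hz ⟨i, hik, h⟩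
  have hAmono : Monotone A := fun k l hkl =>
    Set.biUnion_mono (fun i (hi : i < k) => lt_of_lt_of_le hi hkl) fun _ _ => le_rfl
  have hcover : S ⊆ ⋃ k, f ⁻¹' A k ∩ S := by
    intro x hx
    have hxc : f x ≠ c := by
      intro h
      simp only [hS, Set.mem_ofPred_eq, h, dist_self] at hx
      linarith
    obtain ⟨i, hi⟩ := (TopologicalSpace.denseRange_denseSeq X).exists_mem_open
      ((isOpen_setOf_sameDirection_left c (f x)).preimage hf.continuous)
      ⟨x, sameDirection_self hxc⟩
    refine Set.mem_iUnion.2 ⟨i + 1, Set.mem_iUnion₂.2 ⟨i, i.lt_succ_self, hi⟩, hx⟩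
  have hSle : μ S ≤ κ + κ + κ := by
    by_contra! hcon
    have hAle : ∀ k, μ (f ⁻¹' A k ∩ S) ≤ κ := by
      intro k
      induction k with
      | zero => simp [hA]
      | succ k ih =>
        have hsucc : f ⁻¹' A (k + 1) ∩ S ⊆ (f ⁻¹' A k ∩ S) ∪ (f ⁻¹' C k ∩ S) := by
          rintro x ⟨hx, hxS⟩
          obtain ⟨i, hi, hxi⟩ := Set.mem_iUnion₂.1 hx
          rcases Nat.lt_succ_iff_lt_or_eq.1 hi with h | rfl
          · exact Or.inl ⟨Set.mem_iUnion₂.2 ⟨i, h, hxi⟩, hxS⟩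
          · exact Or.inr ⟨hxi, hxS⟩
        have h2 : μ (f ⁻¹' A (k + 1) ∩ S) ≤ κ + κ :=
          (measure_mono hsucc).trans ((measure_union_le _ _).trans (add_le_add ih (hCle k)))
        rcases le_total (∫ x, branchDist c (A (k + 1)) (f x) ∂μ) 0 with h | h
        · exact hpos _ (hAsat _) h
        · refine absurd ?_ (not_le.2 hcon)
          have h3 := hneg _ (hAsat _) h
          calc μ S ≤ μ ((f ⁻¹' A (k + 1) ∩ S) ∪ (S \ f ⁻¹' A (k + 1))) := by
                refine measure_mono fun x hx => ?_
                by_cases hxA : x ∈ f ⁻¹' A (k + 1)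
                · exact Or.inl ⟨hxA, hx⟩
                · exact Or.inr ⟨hx, hxA⟩
            _ ≤ _ := (measure_union_le _ _).trans (add_le_add h2 h3)
    have hmono : Monotone fun k => f ⁻¹' A k ∩ S := fun k l hkl =>
      Set.inter_subset_inter_left _ (Set.preimage_mono (hAmono hkl))
    have : μ S ≤ κ := by
      refine (measure_mono hcover).trans ?_
      rw [hmono.measure_iUnion]
      exact iSup_le hAle
    refine absurd (this.trans ?_) (not_le.2 hcon)
    rw [add_assoc]
    exact le_self_add
  rw [cRad_map μ hfm]
  refine sInf_le ⟨ENNReal.ofReal_pos.2 hδ0, ?_⟩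
  have hsub : Set.univ ⊆ S ∪ {x | edist (f x) c ≤ ENNReal.ofReal δ} := by
    intro x _
    by_cases hx : x ∈ S
    · exact Or.inl hx
    · refine Or.inr ?_
      simp only [hS, Set.mem_ofPred_eq, not_lt] at hx
      rw [Set.mem_ofPred_eq, edist_dist, dist_comm]
      exact ENNReal.ofReal_le_ofReal hx
  refine tsub_le_iff_left.2 ((measure_mono hsub).trans ((measure_union_le _ _).trans ?_))
  exact add_le_add hSle le_rfl

theorem isRTree_ulift_real : IsRTree (ULift.{v} ℝ) := by
  refine ⟨inferInstance, fun z w => ?_, fun x y z w => ?_⟩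
  · rcases le_total z.down w.down with h | h
    · have hd : dist z w = w.down - z.down := by
        rw [ULift.dist_eq, Real.dist_eq, abs_sub_comm, abs_of_nonneg (by linarith)]
      refine ⟨fun t => ⟨z.down + t⟩, ?_, ?_, fun s _ t _ => ?_⟩
      · ext; simp
      · ext; simp [hd]
      · simp [ULift.dist_eq, Real.dist_eq]
    · have hd : dist z w = z.down - w.down := by
        rw [ULift.dist_eq, Real.dist_eq, abs_of_nonneg (by linarith)]
      refine ⟨fun t => ⟨z.down - t⟩, ?_, ?_, fun s _ t _ => ?_⟩
      · ext; simp
      · ext; simp [hd]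
      · rw [ULift.dist_eq, Real.dist_eq, abs_sub_comm]
        congr 1
        ring
  · simp only [ULift.dist_eq, Real.dist_eq]
    grind

/-- Lifting the screen `ℝ` to another universe does not decrease the observable central
radius. -/
theorem obsCRad_real_le_ulift {X : Type*} [MetricSpace X] [MeasurableSpace X] [BorelSpace X]
    (μ : Measure X) (κ : ℝ≥0∞) [MeasurableSpace (ULift.{v} ℝ)] [BorelSpace (ULift.{v} ℝ)] :
    obsCRad ℝ μ κ ≤ obsCRad (ULift.{v} ℝ) μ κ := by
  refine iSup₂_le fun f hf => iSup₂_le fun c hc => ?_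
  have hf' : LipschitzWith 1 fun x => (ULift.up (f x) : ULift.{v} ℝ) := hf
  have hfm := hf.continuous.measurable
  have hfm' := hf'.continuous.measurable
  have hc' : IsCenterOfMass (Measure.map (fun x => (ULift.up (f x) : ULift.{v} ℝ)) μ)
      (ULift.up c) := by
    intro z x hx
    have h := hc z.down x.down fun h => hx (ULift.ext _ _ h)
    rw [integral_sq_dist_sub_map μ hfm, integral_sq_dist_sub_map μ hfm] at h
    rw [integral_sq_dist_sub_map μ hfm', integral_sq_dist_sub_map μ hfm']
    exact h
  refine le_iSup₂_of_le _ hf' (le_iSup₂_of_le _ hc' (le_of_eq ?_))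
  rw [cRad_map μ hfm, cRad_map μ hfm']
  rfl

/-- For a sequence of mm-spaces with finite first moments,
`ObsCRad_ℝ(X_n; -κ) → 0` for every `κ > 0` iff
`sup { ObsCRad_T(X_n; -κ) : T an ℝ-tree } → 0` for every `κ > 0`. -/
theorem obsCRad_real_tendsto_iff_tree (X : ℕ → Type u)
    [∀ n, MetricSpace (X n)] [∀ n, CompleteSpace (X n)]
    [∀ n, TopologicalSpace.SeparableSpace (X n)]
    [∀ n, MeasurableSpace (X n)] [∀ n, BorelSpace (X n)]
    (μ : ∀ n, Measure (X n)) [∀ n, IsFiniteMeasure (μ n)]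
    (hmom : ∀ n, FiniteFirstMoment (μ n)) :
    (∀ κ : ℝ≥0∞, 0 < κ → κ ≠ ⊤ →
        Filter.Tendsto (fun n => obsCRad ℝ (μ n) κ) Filter.atTop (nhds 0))
      ↔
    (∀ κ : ℝ≥0∞, 0 < κ → κ ≠ ⊤ → ∀ ε : ℝ≥0∞, 0 < ε → ∃ N : ℕ, ∀ n ≥ N,
        ∀ (T : Type v) [MetricSpace T] [MeasurableSpace T] [BorelSpace T],
          IsRTree T → obsCRad T (μ n) κ ≤ ε) := by
  constructor
  · intro h κ hκ hκt ε hε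
    have hκ3 : 0 < κ / 3 := ENNReal.div_pos hκ.ne' (by norm_num)
    have hsum : κ / 3 + κ / 3 + κ / 3 = κ := ENNReal.add_thirds κ
    have hε' : min ε 1 ≠ ⊤ := ne_top_of_le_ne_top ENNReal.one_ne_top (min_le_right _ _)
    have hev := (h (κ / 3) hκ3 (ENNReal.div_ne_top hκt (by norm_num))).eventually
      (gt_mem_nhds (lt_min hε one_pos))
    obtain ⟨N, hN⟩ := Filter.eventually_atTop.1 hev
    refine ⟨N, fun n hn T _ _ _ hT => ?_⟩
    have h1 := hN n hn
    rw [← ENNReal.ofReal_toReal hε'] at h1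
    have h2 := obsCRad_tree_le (μ n) (hmom n) h1 hT
    rw [hsum, ENNReal.ofReal_toReal hε'] at h2
    exact h2.trans (min_le_left _ _)
  · intro h κ hκ hκt
    rw [ENNReal.tendsto_atTop_zero]
    intro ε hε
    obtain ⟨N, hN⟩ := h κ hκ hκt ε hε
    refine ⟨N, fun n hn => ?_⟩
    let _ : MeasurableSpace (ULift.{v} ℝ) := borel _
    have : BorelSpace (ULift.{v} ℝ) := ⟨rfl⟩
    exact (obsCRad_real_le_ulift (μ n) κ).trans (hN n hn (ULift.{v} ℝ) isRTree_ulift_real)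
end
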